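/- arXiv:0907.5192 — 7 statements merged into one kernel-verified Lean document; each statement's English description precedes it below -/
import Mathlib

section
/- Let k ≥ 1, let p, q be complex numbers with p + q = 1, q ≠ 0, p ≠ q, set τ = p/q, and let ρ be a complex number. Let ξ_1, …, ξ_k be complex numbers such that p + q·ξ_i·ξ_j − ξ_i ≠ 0 for all i ≠ j, ξ_i − 1 + ρ(1−τ) ≠ 0 for all i, and for every nonempty subset T ⊆ {1,…,k} one has ∏_{j∈T} ξ_j − (1 − ρ + τ^{|T|} ρ) ≠ 0. Then ∑_{σ ∈ S_k} sgn(σ) · ∏_{i<j} 1/(p + q·ξ_{σ(i)}·ξ_{σ(j)} − ξ_{σ(i)}) · ∏_{i=1}^{k} 1/(ξ_{σ(i)}·ξ_{σ(i+1)}⋯ξ_{σ(k)} − 1 + ρ − τ^{k−i+1}ρ) = q^{k(k−1)/2} · ∏_{i<j}(ξ_i − ξ_j) / ( ∏_{i=1}^{k}(ξ_i − 1 + ρ(1−τ)) · ∏_{i≠j}(p + q·ξ_i·ξ_j − ξ_i) ). -/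
open Finset

open Polynomial in
/-- A partial-fraction identity, obtained by Lagrange interpolation at the nodes `s ∪ {1, p / q}`. -/
theorem sum_prod_div_sub_of_notMem {p q : ℂ} (ρ : ℂ) (hpq : p + q = 1) (hq : q ≠ 0)
    (hpneq : p ≠ q) (s : Finset ℂ) (hs1 : (1 : ℂ) ∉ s) (hsτ : p / q ∉ s) :
    q * ∑ x ∈ s, (x - 1 + ρ * (1 - p / q)) *
        ∏ y ∈ s.erase x, (p + q * y * x - y) / (x - y) =
      q ^ #s * ((∏ y ∈ s, y) - 1 + ρ - (p / q) ^ #s * ρ) := by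
  obtain ⟨τ, hτ⟩ : ∃ τ, τ = p / q := ⟨_, rfl⟩
  rw [← hτ] at hsτ ⊢
  have hp : p = q * τ := by rw [hτ]; field_simp
  have hτ1 : τ ≠ 1 := fun h => hpneq (by rw [hp, h, mul_one])
  have hqτ : q * τ = 1 - q := by rw [← hp]; linear_combination hpq
  set N : ℂ[X] := (X - C (1 - ρ * (1 - τ))) * ∏ y ∈ s, (C (q * y) * X + C (p - y)) with hN
  have hlin (y : ℂ) : (C (q * y) * X + C (p - y)).natDegree ≤ 1 := natDegree_linear_le
  have hprod : (∏ y ∈ s, (C (q * y) * X + C (p - y))).natDegree ≤ #s := by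
    simpa using (natDegree_prod_le s _).trans (sum_le_card_nsmul s _ 1 fun y _ => hlin y)
  have hdeg : N.natDegree ≤ #s + 1 := by
    rw [add_comm]
    exact natDegree_mul_le_of_le (natDegree_X_sub_C_le _) hprod
  have hcoeff : N.coeff (#s + 1) = q ^ #s * ∏ y ∈ s, y := by
    rw [hN, add_comm, coeff_mul_add_eq_of_natDegree_le (natDegree_X_sub_C_le _) hprod]
    have := coeff_prod_of_natDegree_le s (fun y => C (q * y) * X + C (p - y)) 1
      fun y _ => hlin y
    rw [mul_one] at this
    rw [this, coeff_sub, coeff_X_one, coeff_C_of_ne_zero one_ne_zero, sub_zero, one_mul]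
    simp [coeff_C, ← prod_const, ← prod_mul_distrib]
  have heval (x : ℂ) : N.eval x = (x - 1 + ρ * (1 - τ)) * ∏ y ∈ s, (p + q * y * x - y) := by
    simp only [hN, eval_mul, eval_sub, eval_X, eval_C, eval_prod, eval_add]
    congr 1
    · ring
    · exact prod_congr rfl fun y _ => by ring
  have h1s : (1 : ℂ) ∉ insert τ s := by simp [hs1, hτ1.symm]
  have hcard : #(insert 1 (insert τ s)) = #s + 2 := by
    rw [card_insert_of_notMem h1s, card_insert_of_notMem hsτ]
  have key := Lagrange.coeff_eq_sum (s := insert 1 (insert τ s)) (v := fun x : ℂ => x)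
    (fun _ _ _ _ h => h) (P := N) (by
      rw [hcard]
      refine (degree_le_natDegree).trans_lt ?_
      exact_mod_cast Nat.lt_succ_of_le hdeg)
  rw [hcard, show #s + 2 - 1 = #s + 1 by omega, hcoeff, sum_insert h1s, sum_insert hsτ,
    erase_insert h1s, erase_insert_of_ne hτ1.symm, erase_insert hsτ, prod_insert hsτ,
    prod_insert hs1] at key
  have hone : N.eval 1 / ((1 - τ) * ∏ y ∈ s, (1 - y)) = q ^ #s * (ρ * τ ^ #s) := by
    have h0 : ∏ y ∈ s, (1 - y) ≠ 0 :=
      prod_ne_zero_iff.2 fun y hy h => hs1 (by rwa [sub_eq_zero.1 h])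
    have : ∏ y ∈ s, (p + q * y * 1 - y) = (q * τ) ^ #s * ∏ y ∈ s, (1 - y) := by
      rw [← prod_const, ← prod_mul_distrib]
      exact prod_congr rfl fun y _ => by linear_combination hp + y * hqτ
    rw [heval, this, div_eq_iff (mul_ne_zero (sub_ne_zero.2 hτ1.symm) h0)]
    ring
  have htau : N.eval τ / ((τ - 1) * ∏ y ∈ s, (τ - y)) = q ^ #s * (1 - ρ) := by
    have h0 : ∏ y ∈ s, (τ - y) ≠ 0 :=
      prod_ne_zero_iff.2 fun y hy h => hsτ (by rwa [sub_eq_zero.1 h])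
    have : ∏ y ∈ s, (p + q * y * τ - y) = q ^ #s * ∏ y ∈ s, (τ - y) := by
      rw [← prod_const, ← prod_mul_distrib]
      exact prod_congr rfl fun y _ => by linear_combination hp + y * hqτ
    rw [heval, this, div_eq_iff (mul_ne_zero (sub_ne_zero.2 hτ1) h0)]
    ring
  have hrest : ∑ x ∈ s, N.eval x / ∏ y ∈ (insert 1 (insert τ s)).erase x, (x - y) =
      q * ∑ x ∈ s, (x - 1 + ρ * (1 - τ)) * ∏ y ∈ s.erase x, (p + q * y * x - y) / (x - y) := by
    rw [mul_sum]
    refine sum_congr rfl fun x hx => ?_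
    have hx1 : x ≠ 1 := fun h => hs1 (h ▸ hx)
    have hxτ : x ≠ τ := fun h => hsτ (h ▸ hx)
    have h0 : ∏ y ∈ s.erase x, (x - y) ≠ 0 :=
      prod_ne_zero_iff.2 fun y hy => sub_ne_zero.2 (ne_of_mem_erase hy).symm
    have hτs : τ ∉ s.erase x := fun h => hsτ (mem_of_mem_erase h)
    have h1' : (1 : ℂ) ∉ insert τ (s.erase x) := by simp [hs1, hτ1.symm]
    rw [erase_insert_of_ne hx1.symm, erase_insert_of_ne hxτ.symm, prod_insert h1',
      prod_insert hτs, heval, ← mul_prod_erase s _ hx, prod_div_distrib]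
    have e : p + q * x * x - x = q * ((x - 1) * (x - τ)) := by
      linear_combination hp + x * hqτ
    have := sub_ne_zero.2 hx1
    have := sub_ne_zero.2 hxτ
    rw [e]
    field_simp
  rw [hone, htau, hrest] at key
  linear_combination -key

open Filter Topology in
/-- `sum_prod_div_sub_of_notMem` for arbitrary distinct nodes, by perturbing the nodes. -/
theorem sum_prod_div_sub {ι : Type*} [Fintype ι] [DecidableEq ι] {p q : ℂ} (ρ : ℂ)
    (hpq : p + q = 1) (hq : q ≠ 0) (hpneq : p ≠ q) (ξ : ι → ℂ) (hξ : Function.Injective ξ) :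
    q * ∑ i, (ξ i - 1 + ρ * (1 - p / q)) *
        ∏ j ∈ univ.erase i, (p + q * ξ j * ξ i - ξ j) / (ξ i - ξ j) =
      q ^ Fintype.card ι *
        ((∏ j, ξ j) - 1 + ρ - (p / q) ^ Fintype.card ι * ρ) := by
  have hev (a : ℂ) : ∀ᶠ t in 𝓝[≠] (0 : ℂ), ∀ i, ξ i + t ≠ a := by
    refine eventually_all.2 fun i => ?_
    by_cases h : ξ i = a
    · filter_upwards [self_mem_nhdsWithin] with t ht
      simpa [h] using ht
    · have hc : ContinuousAt (fun t : ℂ => ξ i + t) 0 := by fun_prop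
      exact (hc.eventually_ne (by simpa using h)).filter_mono nhdsWithin_le_nhds
  have hfg : ∀ᶠ t in 𝓝[≠] (0 : ℂ),
      q * ∑ i, ((ξ i + t) - 1 + ρ * (1 - p / q)) *
        ∏ j ∈ univ.erase i, (p + q * (ξ j + t) * (ξ i + t) - (ξ j + t)) / (ξ i - ξ j) =
      q ^ Fintype.card ι *
        ((∏ j, (ξ j + t)) - 1 + ρ - (p / q) ^ Fintype.card ι * ρ) := by
    filter_upwards [hev 1, hev (p / q)] with t ht1 htτ
    have hinj : Function.Injective fun i => ξ i + t := fun i j h => hξ (add_right_cancel h)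
    have herase (i : ι) : (univ.map ⟨_, hinj⟩).erase (ξ i + t) =
        (univ.erase i).map ⟨fun i => ξ i + t, hinj⟩ := (map_erase ⟨_, hinj⟩ univ i).symm
    have := sum_prod_div_sub_of_notMem ρ hpq hq hpneq (univ.map ⟨_, hinj⟩)
      (by simpa using ht1) (by simpa using htτ)
    rw [sum_map, prod_map, card_map, card_univ] at this
    simpa only [Function.Embedding.coeFn_mk, herase, prod_map, add_sub_add_right_eq_sub]
      using this
  have hf : Continuous fun t : ℂ => q * ∑ i, ((ξ i + t) - 1 + ρ * (1 - p / q)) *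
        ∏ j ∈ univ.erase i, (p + q * (ξ j + t) * (ξ i + t) - (ξ j + t)) / (ξ i - ξ j) := by
    fun_prop
  have hg : Continuous fun t : ℂ => q ^ Fintype.card ι *
        ((∏ j, (ξ j + t)) - 1 + ρ - (p / q) ^ Fintype.card ι * ρ) := by
    fun_prop
  have := tendsto_nhds_unique_of_eventuallyEq
    ((hf.tendsto 0).mono_left nhdsWithin_le_nhds) ((hg.tendsto 0).mono_left nhdsWithin_le_nhds) hfg
  simpa using this

/-- The summand of the symmetrization, without its sign, at a sequence `ζ`. -/
noncomputable def stepWeight (p q ρ τ : ℂ) {k : ℕ} (ζ : Fin k → ℂ) : ℂ :=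
  (∏ i : Fin k, ∏ j ∈ univ.filter (fun j => i < j), (1 / (p + q * ζ i * ζ j - ζ i))) *
    ∏ i : Fin k, (1 / ((∏ l ∈ univ.filter (fun l => i ≤ l), ζ l) - 1 + ρ
      - τ ^ (k - (i : ℕ)) * ρ))

/-- The closed form of the symmetrization of `stepWeight`. -/
noncomputable def stepValue (p q ρ τ : ℂ) {k : ℕ} (ζ : Fin k → ℂ) : ℂ :=
  q ^ (k * (k - 1) / 2) *
    (∏ i : Fin k, ∏ j ∈ univ.filter (fun j => i < j), (ζ i - ζ j)) /
    ((∏ i : Fin k, (ζ i - 1 + ρ * (1 - τ))) *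
      ∏ i : Fin k, ∏ j ∈ univ.filter (fun j => j ≠ i), (p + q * ζ i * ζ j - ζ i))

theorem stepWeight_succ (p q ρ τ : ℂ) {k : ℕ} (ζ : Fin (k + 1) → ℂ) :
    stepWeight p q ρ τ ζ =
      (∏ j : Fin k, (1 / (p + q * ζ 0 * ζ j.succ - ζ 0))) *
        (1 / ((∏ l, ζ l) - 1 + ρ - τ ^ (k + 1) * ρ)) *
        stepWeight p q ρ τ (fun j : Fin k => ζ j.succ) := by
  simp only [stepWeight, prod_filter, Fin.prod_univ_succ (n := k), Fin.succ_pos, if_true,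
    if_false, one_mul, Fin.succ_lt_succ_iff, Fin.not_lt_zero, Fin.zero_le,
    Fin.succ_le_succ_iff, Fin.le_zero_iff, Fin.succ_ne_zero, Fin.val_zero, Fin.val_succ,
    Nat.sub_zero, Nat.add_sub_add_right]
  ring

theorem stepValue_succ (p q ρ τ : ℂ) {k : ℕ} (ζ : Fin (k + 1) → ℂ) :
    stepValue p q ρ τ ζ =
      q ^ k * (∏ j : Fin k, (ζ 0 - ζ j.succ)) /
        ((ζ 0 - 1 + ρ * (1 - τ)) * (∏ j : Fin k, (p + q * ζ 0 * ζ j.succ - ζ 0)) *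
          ∏ j : Fin k, (p + q * ζ j.succ * ζ 0 - ζ j.succ)) *
        stepValue p q ρ τ (fun j : Fin k => ζ j.succ) := by
  rw [stepValue, stepValue, Nat.triangle_succ, pow_add, div_mul_div_comm]
  simp only [prod_filter, Fin.prod_univ_succ (n := k), Fin.succ_pos, if_true,
    if_false, one_mul, Fin.succ_lt_succ_iff, Fin.not_lt_zero, ne_eq,
    not_true_eq_false, not_false_eq_true, Fin.succ_inj, Fin.succ_ne_zero,
    (Fin.succ_ne_zero _).symm, prod_mul_distrib]
  congr 1 <;> ring

theorem stepValue_comp_perm (p q ρ τ : ℂ) {k : ℕ} (ζ : Fin k → ℂ) (π : Equiv.Perm (Fin k)) :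
    stepValue p q ρ τ (fun i => ζ (π i)) =
      ((Equiv.Perm.sign π : ℤ) : ℂ) * stepValue p q ρ τ ζ := by
  have hV := π.prod_Ioi_comp_eq_sign_mul_prod (f := fun i j => ζ i - ζ j) fun i j => by ring
  have hA := Equiv.prod_comp π fun i => ζ i - 1 + ρ * (1 - τ)
  have hD : ∏ i, ∏ j ∈ univ.filter (fun j => j ≠ i),
        (p + q * ζ (π i) * ζ (π j) - ζ (π i)) =
      ∏ i, ∏ j ∈ univ.filter (fun j => j ≠ i), (p + q * ζ i * ζ j - ζ i) := by
    simp only [prod_filter]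
    rw [← Equiv.prod_comp π fun i => ∏ j, if j ≠ i then p + q * ζ i * ζ j - ζ i else 1]
    refine prod_congr rfl fun i _ => ?_
    rw [← Equiv.prod_comp π fun j => if j ≠ π i then p + q * ζ (π i) * ζ j - ζ (π i) else 1]
    simp
  have hIoi (i : Fin k) : univ.filter (fun j => i < j) = Ioi i := by ext; simp
  simp only [stepValue, hA, hD, hIoi, hV]
  ring

theorem sum_sign_mul_stepWeight_of_injective {p q ρ τ : ℂ} (hpq : p + q = 1) (hq : q ≠ 0)
    (hpneq : p ≠ q) (hτ : τ = p / q) {k : ℕ} (ξ : Fin k → ℂ) (hξ : Function.Injective ξ)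
    (h1 : ∀ i j : Fin k, i ≠ j → p + q * ξ i * ξ j - ξ i ≠ 0)
    (h2 : ∀ i : Fin k, ξ i - 1 + ρ * (1 - τ) ≠ 0)
    (h3 : ∀ T : Finset (Fin k), T.Nonempty →
      (∏ j ∈ T, ξ j) - (1 - ρ + τ ^ T.card * ρ) ≠ 0) :
    ∑ σ : Equiv.Perm (Fin k),
      ((Equiv.Perm.sign σ : ℤ) : ℂ) * stepWeight p q ρ τ (fun i => ξ (σ i)) =
      stepValue p q ρ τ ξ := by
  induction k with
  | zero => simp [stepWeight, stepValue]
  | succ k ih =>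
    set D : ℂ := (∏ l, ξ l) - 1 + ρ - τ ^ (k + 1) * ρ with hD
    have hD0 : D ≠ 0 := by
      have := h3 univ univ_nonempty
      rw [card_univ, Fintype.card_fin] at this
      convert this using 1
      rw [hD]
      ring
    have hterm (m : Fin (k + 1)) :
        ∑ e : Equiv.Perm (Fin k),
          ((Equiv.Perm.sign (Equiv.Perm.decomposeFin.symm (m, e)) : ℤ) : ℂ) *
            stepWeight p q ρ τ (fun i => ξ (Equiv.Perm.decomposeFin.symm (m, e) i)) =
        stepValue p q ρ τ ξ / (q ^ k * D) * ((ξ m - 1 + ρ * (1 - τ)) *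
          ∏ j ∈ univ.erase m, (p + q * ξ j * ξ m - ξ j) / (ξ m - ξ j)) := by
      set π := Equiv.swap 0 m with hπ
      have hπ0 : π 0 = m := by simp [hπ]
      have hne (j : Fin k) : m ≠ π j.succ := fun h =>
        (Fin.succ_ne_zero j).symm (π.injective (hπ0.trans h))
      have hsucc : Function.Injective fun j : Fin k => π j.succ :=
        π.injective.comp (Fin.succ_injective k)
      have herase : ∏ j ∈ univ.erase m, (p + q * ξ j * ξ m - ξ j) / (ξ m - ξ j) =
          ∏ j : Fin k, (p + q * ξ (π j.succ) * ξ m - ξ (π j.succ)) / (ξ m - ξ (π j.succ)) := by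
        rw [← filter_ne', prod_filter, ← Equiv.prod_comp π, Fin.prod_univ_succ]
        simp [hπ0, (hne _).symm]
      have hsign (e : Equiv.Perm (Fin k)) :
          ((Equiv.Perm.sign (Equiv.Perm.decomposeFin.symm (m, e)) : ℤ) : ℂ) =
            ((Equiv.Perm.sign π : ℤ) : ℂ) * ((Equiv.Perm.sign e : ℤ) : ℂ) := by
        rw [Equiv.Perm.decomposeFin.symm_sign, hπ, Equiv.Perm.sign_swap']
        by_cases h : m = 0 <;> simp [h, eq_comm (a := (0 : Fin (k + 1)))]
      have hweight (e : Equiv.Perm (Fin k)) :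
          stepWeight p q ρ τ (fun i => ξ (Equiv.Perm.decomposeFin.symm (m, e) i)) =
            (∏ j : Fin k, (1 / (p + q * ξ m * ξ (π j.succ) - ξ m))) * (1 / D) *
              stepWeight p q ρ τ (fun i => ξ (π (e i).succ)) := by
        rw [stepWeight_succ, Equiv.prod_comp _ ξ]
        simp only [Equiv.Perm.decomposeFin_symm_apply_zero,
          Equiv.Perm.decomposeFin_symm_apply_succ]
        rw [Equiv.prod_comp e fun j : Fin k => 1 / (p + q * ξ m * ξ (π j.succ) - ξ m)]
      have hrec := ih (fun j => ξ (π j.succ)) (hξ.comp hsucc)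
        (fun i j hij => h1 _ _ (hsucc.ne hij)) (fun i => h2 _) fun T hT => by
          simpa using h3 (T.map ⟨_, hsucc⟩) (hT.map)
      have hval := stepValue_succ p q ρ τ fun i => ξ (π i)
      rw [stepValue_comp_perm, hπ0] at hval
      have hsq : ((Equiv.Perm.sign π : ℤ) : ℂ) * ((Equiv.Perm.sign π : ℤ) : ℂ) = 1 := by
        
        rw [← Int.cast_mul, ← Units.val_mul, Int.units_mul_self, Units.val_one, Int.cast_one]
      have hR : stepValue p q ρ τ ξ = ((Equiv.Perm.sign π : ℤ) : ℂ) *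
          (((Equiv.Perm.sign π : ℤ) : ℂ) * stepValue p q ρ τ ξ) := by
        rw [← mul_assoc, hsq, one_mul]
      have n1 : ∏ j : Fin k, (ξ m - ξ (π j.succ)) ≠ 0 :=
        prod_ne_zero_iff.2 fun j _ => sub_ne_zero.2 (hξ.ne (hne j))
      have n2 : ∏ j : Fin k, (p + q * ξ m * ξ (π j.succ) - ξ m) ≠ 0 :=
        prod_ne_zero_iff.2 fun j _ => h1 _ _ (hne j)
      have n3 : ∏ j : Fin k, (p + q * ξ (π j.succ) * ξ m - ξ (π j.succ)) ≠ 0 :=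
        prod_ne_zero_iff.2 fun j _ => h1 _ _ (hne j).symm
      have n4 := h2 m
      simp only [hsign, hweight]
      calc _ = ((Equiv.Perm.sign π : ℤ) : ℂ) *
            ((∏ j : Fin k, (1 / (p + q * ξ m * ξ (π j.succ) - ξ m))) * (1 / D)) *
            stepValue p q ρ τ (fun j : Fin k => ξ (π j.succ)) := by
            rw [← hrec, mul_sum]
            exact sum_congr rfl fun e _ => by ring
        _ = _ := by
            rw [hR, hval, herase]
            simp only [prod_div_distrib, prod_const_one]
            generalize ∏ j : Fin k, (p + q * ξ (π j.succ) * ξ m - ξ (π j.succ)) = B at n3 ⊢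
            field_simp
    rw [← Equiv.sum_comp Equiv.Perm.decomposeFin.symm, Fintype.sum_prod_type]
    simp only [hterm]
    have key := sum_prod_div_sub ρ hpq hq hpneq ξ hξ
    rw [← hτ, Fintype.card_fin, ← hD, pow_succ', mul_assoc] at key
    rw [← mul_sum, mul_left_cancel₀ hq key, div_mul_cancel₀ _ (mul_ne_zero (pow_ne_zero k hq) hD0)]

theorem sum_sign_mul_stepWeight_of_not_injective (p q ρ τ : ℂ) {k : ℕ} (ξ : Fin k → ℂ)
    (hξ : ¬ Function.Injective ξ) :
    ∑ σ : Equiv.Perm (Fin k),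
      ((Equiv.Perm.sign σ : ℤ) : ℂ) * stepWeight p q ρ τ (fun i => ξ (σ i)) =
      stepValue p q ρ τ ξ := by
  obtain ⟨a, b, hab, hne⟩ := Function.not_injective_iff.1 hξ
  have hswap (i : Fin k) : ξ (Equiv.swap a b i) = ξ i := by
    rw [Equiv.swap_apply_def]
    split_ifs with h h'
    · rw [h, hab]
    · rw [h', hab]
    · rfl
  have hvalue : stepValue p q ρ τ ξ = 0 := by
    have := stepValue_comp_perm p q ρ τ ξ (Equiv.swap a b)
    simp only [hswap, Equiv.Perm.sign_swap hne] at this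
    push_cast at this
    linear_combination this / 2
  have hsum := Equiv.sum_comp (Equiv.mulLeft (Equiv.swap a b)) fun σ : Equiv.Perm (Fin k) =>
    ((Equiv.Perm.sign σ : ℤ) : ℂ) * stepWeight p q ρ τ (fun i => ξ (σ i))
  simp only [Equiv.coe_mulLeft, Equiv.Perm.mul_apply, hswap, Equiv.Perm.sign_mul,
    Equiv.Perm.sign_swap hne] at hsum
  push_cast at hsum
  simp only [neg_mul, one_mul, sum_neg_distrib] at hsum
  rw [hvalue]
  linear_combination -hsum / 2

/-- The combinatorial identity (III) of Tracy–Widom, "On ASEP with Step Bernoulli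
Initial Condition": for `p + q = 1`, `q ≠ 0`, `p ≠ q`, `τ = p/q`, and complex
`ξ_1, …, ξ_k` avoiding the singularities,
`∑_{σ ∈ S_k} sgn σ ∏_{i<j} 1/(p + q ξ_{σi} ξ_{σj} - ξ_{σi})
  ∏_i 1/(ξ_{σi} ⋯ ξ_{σk} - 1 + ρ - τ^{k-i+1} ρ)
 = q^{k(k-1)/2} ∏_{i<j}(ξ_i - ξ_j) /
   (∏_i (ξ_i - 1 + ρ(1-τ)) ∏_{i≠j}(p + q ξ_i ξ_j - ξ_i))`. -/
theorem combinatorial_identity_step_bernoulli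
    (k : ℕ) (hk : 1 ≤ k) (p q ρ : ℂ) (hpq : p + q = 1) (hq : q ≠ 0)
    (hpneq : p ≠ q) (τ : ℂ) (hτ : τ = p / q) (ξ : Fin k → ℂ)
    (h1 : ∀ i j : Fin k, i ≠ j → p + q * ξ i * ξ j - ξ i ≠ 0)
    (h2 : ∀ i : Fin k, ξ i - 1 + ρ * (1 - τ) ≠ 0)
    (h3 : ∀ T : Finset (Fin k), T.Nonempty →
      (∏ j ∈ T, ξ j) - (1 - ρ + τ ^ T.card * ρ) ≠ 0) :
    ∑ σ : Equiv.Perm (Fin k),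
      ((Equiv.Perm.sign σ : ℤ) : ℂ) *
        (∏ i : Fin k, ∏ j ∈ univ.filter (fun j => i < j),
          (1 / (p + q * ξ (σ i) * ξ (σ j) - ξ (σ i)))) *
        (∏ i : Fin k,
          (1 / ((∏ l ∈ univ.filter (fun l => i ≤ l), ξ (σ l)) - 1 + ρ
              - τ ^ (k - (i : ℕ)) * ρ))) =
      q ^ (k * (k - 1) / 2) *
        (∏ i : Fin k, ∏ j ∈ univ.filter (fun j => i < j), (ξ i - ξ j)) /
        ((∏ i : Fin k, (ξ i - 1 + ρ * (1 - τ))) *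
          ∏ i : Fin k, ∏ j ∈ univ.filter (fun j => j ≠ i),
            (p + q * ξ i * ξ j - ξ i)) := by
  have key : ∑ σ : Equiv.Perm (Fin k),
      ((Equiv.Perm.sign σ : ℤ) : ℂ) * stepWeight p q ρ τ (fun i => ξ (σ i)) =
      stepValue p q ρ τ ξ := by
    by_cases hξ : Function.Injective ξ
    · exact sum_sign_mul_stepWeight_of_injective hpq hq hpneq hτ ξ hξ h1 h2 h3
    · exact sum_sign_mul_stepWeight_of_not_injective p q ρ τ ξ hξ
  simpa only [stepWeight, stepValue, mul_assoc] using key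
end

section
/- Let k ≥ 1, let p, q be complex numbers with p + q = 1, q ≠ 0, p ≠ q, set τ = p/q, and let c be a complex number. Let ξ_1, …, ξ_k be pairwise distinct complex numbers. Then ∑_{ℓ=1}^{k} (ξ_ℓ − c) · ∏_{i≠ℓ}(p + q·ξ_i·ξ_ℓ − ξ_i) / ∏_{i≠ℓ}(ξ_ℓ − ξ_i) = q^{k−1} · ( ∏_{i=1}^{k} ξ_i − ((1−c)/(1−τ))·τ^k − (τ−c)/(τ−1) ). -/
open Finset

open Polynomial in
/-- The sum of `(z - c) ∏ i, (p + q ξ_i z - ξ_i)` against the interpolation weights of the nodes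
`1`, `a`, `ξ_1, …, ξ_k` is its coefficient of degree `k + 1`. -/
theorem sum_node_weights_eq_prod {K : Type*} [Field K] {k : ℕ} (p q c a : K) (ξ : Fin k → K)
    (hinj : Function.Injective ξ) (ha : a ≠ 1) (h1 : ∀ i, ξ i ≠ 1) (h2 : ∀ i, ξ i ≠ a) :
    (1 - c) * (∏ i, (p + q * ξ i * 1 - ξ i)) / ((1 - a) * ∏ i, (1 - ξ i)) +
      ((a - c) * (∏ i, (p + q * ξ i * a - ξ i)) / ((a - 1) * ∏ i, (a - ξ i)) +
      ∑ l, (ξ l - c) * (∏ i, (p + q * ξ i * ξ l - ξ i)) /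
        ((ξ l - 1) * ((ξ l - a) * ∏ i ∈ univ.filter (fun i => i ≠ l), (ξ l - ξ i)))) =
      ∏ i, (q * ξ i) := by
  let v : Option (Option (Fin k)) → K := fun x => x.elim 1 (fun y => y.elim a ξ)
  have hv : Function.Injective v := by
    rintro (_ | _ | i) (_ | _ | j) h <;> simp only [v, Option.elim] at h
    · rfl
    · exact absurd h.symm ha
    · exact absurd h.symm (h1 j)
    · exact absurd h ha
    · rfl
    · exact absurd h.symm (h2 j)
    · exact absurd h (h1 i)
    · exact absurd h (h2 i)
    · rw [hinj h]
  let F : K[X] := ∏ i, (C (q * ξ i) * X + C (p - ξ i))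
  let P : K[X] := (C 1 * X + C (-c)) * F
  have hF : F.natDegree ≤ k := by
    refine (natDegree_prod_le _ _).trans
      ((sum_le_card_nsmul _ _ 1 fun i _ => natDegree_linear_le).trans ?_)
    simp
  have hP : P.degree < #(univ : Finset (Option (Option (Fin k)))) := by
    have hdeg : P.natDegree ≤ 1 + k := natDegree_mul_le.trans (add_le_add natDegree_linear_le hF)
    refine (natDegree_le_iff_degree_le.mp hdeg).trans_lt ?_
    simp only [card_univ, Fintype.card_option, Fintype.card_fin]
    exact_mod_cast (by omega : 1 + k < k + 1 + 1)
  have hcoeff : P.coeff (#(univ : Finset (Option (Option (Fin k)))) - 1) = ∏ i, (q * ξ i) := by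
    have hFk : F.coeff k = ∏ i, (q * ξ i) := by
      have := coeff_prod_of_natDegree_le (s := univ)
        (fun i : Fin k => C (q * ξ i) * X + C (p - ξ i)) 1 fun i _ => natDegree_linear_le
      simpa [F, coeff_C] using this
    have hcard : #(univ : Finset (Option (Option (Fin k)))) - 1 = 1 + k := by
      simp [add_comm]
    rw [hcard, coeff_mul_add_eq_of_natDegree_le natDegree_linear_le hF, hFk]
    simp
  have heval (x : K) : P.eval x = (x - c) * ∏ i, (p + q * ξ i * x - ξ i) := by
    simp only [P, F, eval_mul, eval_add, eval_C, eval_X, eval_prod]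
    congr 1
    · ring
    · exact prod_congr rfl fun i _ => by ring
  have hsum := Lagrange.coeff_eq_sum hv.injOn hP
  rw [hcoeff] at hsum
  have herase (x : Option (Option (Fin k))) (f : Option (Option (Fin k)) → K) :
      ∏ j ∈ univ.erase x, f j = ∏ j, if j ≠ x then f j else 1 := by
    rw [← prod_filter, filter_ne']
  rw [hsum]
  simp only [herase, Fintype.sum_option, Fintype.prod_option, heval, prod_filter]
  simp [v]

/-- The residue identity when no `ξ_i` is a root of `p + q z ^ 2 - z`. -/
theorem residue_sum_identity_of_ne
    {K : Type*} [Field K] {k : ℕ} (hk : 1 ≤ k) (p q c : K) (hpq : p + q = 1) (hq : q ≠ 0)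
    (hpneq : p ≠ q) (τ : K) (hτ : τ = p / q) (ξ : Fin k → K)
    (hinj : Function.Injective ξ) (h1 : ∀ i, ξ i ≠ 1) (h2 : ∀ i, ξ i ≠ τ) :
    ∑ l : Fin k,
      (ξ l - c) * (∏ i ∈ univ.filter (fun i => i ≠ l), (p + q * ξ i * ξ l - ξ i)) /
        (∏ i ∈ univ.filter (fun i => i ≠ l), (ξ l - ξ i)) =
      q ^ (k - 1) *
        ((∏ i : Fin k, ξ i) - ((1 - c) / (1 - τ)) * τ ^ k - (τ - c) / (τ - 1)) := by
  have hp : p = q * τ := by rw [hτ]; field_simp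
  have hτ1 : τ ≠ 1 := fun h => hpneq (by rw [hp, h, mul_one])
  have hq' : q * τ = 1 - q := by rw [← hp, ← hpq]; ring
  have key := sum_node_weights_eq_prod p q c τ ξ hinj hτ1 h1 h2
  have hprod1 : ∏ i, (p + q * ξ i * 1 - ξ i) = p ^ k * ∏ i, (1 - ξ i) := by
    rw [← Fin.prod_const, ← prod_mul_distrib]
    exact prod_congr rfl fun i _ => by linear_combination ξ i * hpq
  have hprodτ : ∏ i, (p + q * ξ i * τ - ξ i) = q ^ k * ∏ i, (τ - ξ i) := by
    rw [← Fin.prod_const, ← prod_mul_distrib]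
    exact prod_congr rfl fun i _ => by linear_combination hp + ξ i * hq'
  have hterm (l : Fin k) : (ξ l - c) * (∏ i, (p + q * ξ i * ξ l - ξ i)) /
        ((ξ l - 1) * ((ξ l - τ) * ∏ i ∈ univ.filter (fun i => i ≠ l), (ξ l - ξ i))) =
      q * ((ξ l - c) * (∏ i ∈ univ.filter (fun i => i ≠ l), (p + q * ξ i * ξ l - ξ i)) /
        (∏ i ∈ univ.filter (fun i => i ≠ l), (ξ l - ξ i))) := by
    have hl1 : ξ l - 1 ≠ 0 := sub_ne_zero.mpr (h1 l)
    have hlτ : ξ l - τ ≠ 0 := sub_ne_zero.mpr (h2 l)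
    have hfactor : p + q * ξ l * ξ l - ξ l = q * ((ξ l - 1) * (ξ l - τ)) := by
      linear_combination hp + ξ l * hq'
    rw [← mul_prod_erase univ _ (mem_univ l), ← filter_ne', hfactor]
    have hne : ∏ i ∈ univ.filter (fun i => i ≠ l), (ξ l - ξ i) ≠ 0 :=
      prod_ne_zero_iff.mpr fun i hi =>
        sub_ne_zero.mpr fun h => (mem_filter.mp hi).2 (hinj h).symm
    field_simp
  have hne1 : ∏ i, (1 - ξ i) ≠ 0 :=
    prod_ne_zero_iff.mpr fun i _ => sub_ne_zero.mpr (h1 i).symm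
  have hneτ : ∏ i, (τ - ξ i) ≠ 0 :=
    prod_ne_zero_iff.mpr fun i _ => sub_ne_zero.mpr (h2 i).symm
  rw [hprod1, hprodτ, ← mul_assoc, ← mul_assoc, mul_div_mul_right _ _ hne1,
    mul_div_mul_right _ _ hneτ, prod_mul_distrib, Fin.prod_const,
    sum_congr rfl fun l _ => hterm l, ← mul_sum, hp, mul_pow, ← hp] at key
  obtain ⟨n, rfl⟩ := Nat.exists_eq_add_of_le' hk
  refine mul_left_cancel₀ hq ?_
  rw [Nat.add_sub_cancel]
  linear_combination key

/-- The rational-function identity from §III of Tracy–Widom, "On ASEP with Step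
Bernoulli Initial Condition": for pairwise distinct `ξ_1, …, ξ_k`,
`∑_ℓ (ξ_ℓ - c) ∏_{i≠ℓ}(p + q ξ_i ξ_ℓ - ξ_i) / ∏_{i≠ℓ}(ξ_ℓ - ξ_i)
 = q^{k-1} (∏_i ξ_i - ((1-c)/(1-τ)) τ^k - (τ-c)/(τ-1))`. -/
theorem residue_sum_identity
    (k : ℕ) (hk : 1 ≤ k) (p q c : ℂ) (hpq : p + q = 1) (hq : q ≠ 0)
    (hpneq : p ≠ q) (τ : ℂ) (hτ : τ = p / q) (ξ : Fin k → ℂ)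
    (hinj : Function.Injective ξ) :
    ∑ l : Fin k,
      (ξ l - c) * (∏ i ∈ univ.filter (fun i => i ≠ l), (p + q * ξ i * ξ l - ξ i)) /
        (∏ i ∈ univ.filter (fun i => i ≠ l), (ξ l - ξ i)) =
      q ^ (k - 1) *
        ((∏ i : Fin k, ξ i) - ((1 - c) / (1 - τ)) * τ ^ k - (τ - c) / (τ - 1)) := by
  let f : ℂ → ℂ := fun t => ∑ l : Fin k,
      (ξ l + t - c) * (∏ i ∈ univ.filter (fun i => i ≠ l),
        (p + q * (ξ i + t) * (ξ l + t) - (ξ i + t))) /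
        (∏ i ∈ univ.filter (fun i => i ≠ l), (ξ l - ξ i))
  let g : ℂ → ℂ := fun t => q ^ (k - 1) *
        ((∏ i : Fin k, (ξ i + t)) - ((1 - c) / (1 - τ)) * τ ^ k - (τ - c) / (τ - 1))
  have hf : Continuous f := by fun_prop
  have hg : Continuous g := by fun_prop
  let S : Set ℂ := Set.range (fun i => 1 - ξ i) ∪ Set.range (fun i => τ - ξ i)
  have hS : S.Countable := ((Set.finite_range _).union (Set.finite_range _)).countable
  have hfg : Set.EqOn f g Sᶜ := by
    intro t ht
    have h := residue_sum_identity_of_ne hk p q c hpq hq hpneq τ hτ (fun i => ξ i + t)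
      (fun i j hij => hinj (add_right_cancel hij))
      (fun i hi => ht (Or.inl ⟨i, by linear_combination -hi⟩))
      (fun i hi => ht (Or.inr ⟨i, by linear_combination -hi⟩))
    simpa only [add_sub_add_right_eq_sub] using h
  have h := congrFun (hf.ext_on (hS.dense_compl ℂ) hg hfg) 0
  simpa only [f, g, add_zero] using h
end

section
/- Let ρ and τ be real numbers, let N ≥ 1, and let S = {s_1 < s_2 < ⋯ < s_k} be a subset of {1, 2, …, N} with k ≥ 1 elements; set s_0 = 0. Then ∑_{Y : S ⊆ Y ⊆ {1,…,N}} ρ^{|Y|} (1−ρ)^{N−|Y|} τ^{σ(S,Y)} = τ^{k(k+1)/2} · ρ^k · ∏_{i=1}^{k} (1 − ρ + τ^{k−i+1} ρ)^{s_i − s_{i−1} − 1}, where the sum is over all subsets Y of {1,…,N} containing S. -/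
open Finset

/-- `sigmaPairs U V = σ(U,V)` is the number of pairs `(u,v)` with `u ∈ U`,
`v ∈ V` and `u ≥ v`. -/
def sigmaPairs (U V : Finset ℕ) : ℕ :=
  ((U ×ˢ V).filter (fun p => p.2 ≤ p.1)).card

theorem sum_superset_prod_eq_prod_ite {ι R : Type*} [DecidableEq ι] [CommSemiring R]
    {S T : Finset ι} (hST : S ⊆ T) (f g : ι → R) :
    ∑ Y ∈ T.powerset.filter (fun Y => S ⊆ Y), (∏ y ∈ Y, f y) * ∏ y ∈ T \ Y, g y =
      ∏ y ∈ T, (f y + if y ∈ S then 0 else g y) := by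
  rw [Finset.prod_add, Finset.sum_filter]
  refine Finset.sum_congr rfl fun Y _ => ?_
  split_ifs with h
  · congr 1
    refine Finset.prod_congr rfl fun y hy => ?_
    rw [if_neg fun hyS => (Finset.mem_sdiff.mp hy).2 (h hyS)]
  · obtain ⟨y, hyS, hyY⟩ := Finset.not_subset.mp h
    have h0 : ∏ y ∈ T \ Y, (if y ∈ S then 0 else g y) = 0 :=
      Finset.prod_eq_zero (Finset.mem_sdiff.mpr ⟨hST hyS, hyY⟩) (if_pos hyS)
    rw [h0, mul_zero]

theorem sigmaPairs_eq_sum_card (U V : Finset ℕ) :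
    sigmaPairs U V = ∑ v ∈ V, (U.filter (fun u => v ≤ u)).card := by
  simp only [sigmaPairs, Finset.card_filter, Finset.sum_product_right]

theorem weight_eq_prod (ρ τ : ℝ) (N : ℕ) (S : Finset ℕ) {Y : Finset ℕ}
    (hY : Y ⊆ Finset.Icc 1 N) :
    ρ ^ Y.card * (1 - ρ) ^ (N - Y.card) * τ ^ sigmaPairs S Y =
      (∏ y ∈ Y, τ ^ (S.filter (fun u => y ≤ u)).card * ρ) *
        ∏ _y ∈ Finset.Icc 1 N \ Y, (1 - ρ) := by
  rw [Finset.prod_mul_distrib, Finset.prod_const, Finset.prod_const,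
    Finset.card_sdiff_of_subset hY, Nat.card_Icc, Nat.add_sub_cancel,
    Finset.prod_pow_eq_pow_sum, sigmaPairs_eq_sum_card]
  ring

theorem lt_of_lt_succ_of_le {s : ℕ → ℕ} {k : ℕ} (hmono : ∀ i, i < k → s i < s (i + 1))
    {i j : ℕ} (hij : i < j) (hj : j ≤ k) : s i < s j := by
  induction j, hij using Nat.le_induction with
  | base => exact hmono i hj
  | succ j _ ih => exact (ih (by omega)).trans (hmono j hj)

theorem card_filter_le_image {s : ℕ → ℕ} {k : ℕ} (hmono : ∀ i, i < k → s i < s (i + 1))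
    {j y : ℕ} (hjk : j ≤ k) (hy : s j < y) (hy' : j < k → y ≤ s (j + 1)) :
    (((Finset.Icc 1 k).image s).filter (fun u => y ≤ u)).card = k - j := by
  have hinj : Set.InjOn s (Finset.Icc (j + 1) k) := by
    intro a ha b hb hab
    simp only [Finset.coe_Icc, Set.mem_Icc] at ha hb
    rcases lt_trichotomy a b with h | h | h
    · exact absurd hab (lt_of_lt_succ_of_le hmono h hb.2).ne
    · exact h
    · exact absurd hab (lt_of_lt_succ_of_le hmono h ha.2).ne'
  have heq : ((Finset.Icc 1 k).image s).filter (fun u => y ≤ u) =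
      (Finset.Icc (j + 1) k).image s := by
    ext u
    simp only [Finset.mem_filter, Finset.mem_image, Finset.mem_Icc]
    constructor
    · rintro ⟨⟨i, ⟨hi1, hik⟩, rfl⟩, hyi⟩
      refine ⟨i, ⟨?_, hik⟩, rfl⟩
      by_contra! hlt
      rcases (Nat.lt_succ_iff.mp hlt).eq_or_lt with rfl | h
      · omega
      · have := lt_of_lt_succ_of_le hmono h hjk
        omega
    · rintro ⟨i, ⟨hji, hik⟩, rfl⟩
      refine ⟨⟨i, ⟨by omega, hik⟩, rfl⟩, (hy' (by omega)).trans ?_⟩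
      rcases hji.eq_or_lt with rfl | h
      · exact le_rfl
      · exact (lt_of_lt_succ_of_le hmono h hik).le
  rw [heq, Finset.card_image_of_injOn hinj, Nat.card_Icc]
  omega

theorem prod_Icc_pow_sub_add_one (τ : ℝ) (k : ℕ) :
    ∏ i ∈ Finset.Icc 1 k, τ ^ (k - i + 1) = τ ^ (k * (k + 1) / 2) := by
  rw [Finset.prod_pow_eq_pow_sum]
  congr 1
  have h : ∑ i ∈ Finset.Icc 1 k, (k - i + 1) = ∑ i ∈ Finset.range (k + 1), i := by
    rw [Finset.sum_range_succ', add_zero]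
    refine Finset.sum_bij' (fun i _ => k - i) (fun i _ => k - i) ?_ ?_ ?_ ?_ ?_ <;> grind
  rw [h, Finset.sum_range_id, Nat.add_sub_cancel, mul_comm]

theorem prod_Ioc_eq_of_forall_lt {a b : ℕ} (hab : a < b) {F : ℕ → ℝ} {c : ℝ}
    (hF : ∀ y, a < y → y < b → F y = c) :
    ∏ y ∈ Finset.Ioc a b, F y = c ^ (b - a - 1) * F b := by
  rw [← Finset.Ioo_insert_right hab, Finset.prod_insert Finset.right_notMem_Ioo, mul_comm,
    Finset.prod_congr rfl fun y hy => hF y (Finset.mem_Ioo.mp hy).1 (Finset.mem_Ioo.mp hy).2,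
    Finset.prod_const, Nat.card_Ioo]

theorem prod_Ioc_eq_prod_Icc_blocks {s : ℕ → ℕ} (hs0 : s 0 = 0) {k : ℕ}
    (hmono : ∀ i, i < k → s i < s (i + 1)) (F : ℕ → ℝ) :
    ∏ y ∈ Finset.Ioc 0 (s k), F y =
      ∏ i ∈ Finset.Icc 1 k, ∏ y ∈ Finset.Ioc (s (i - 1)) (s i), F y := by
  induction k with
  | zero => simp [hs0]
  | succ k ih =>
    rw [Finset.prod_Icc_succ_top (by omega), ← ih fun i hi => hmono i (by omega),
      Nat.add_sub_cancel, Finset.prod_Ioc_consecutive _ (Nat.zero_le _) (hmono k k.lt_succ_self).le]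

/-- The average over step Bernoulli initial configurations, §II of Tracy–Widom,
"On ASEP with Step Bernoulli Initial Condition": for `S = {s_1 < ⋯ < s_k} ⊆ [1,N]`
(with `s_0 = 0`),
`∑_{S ⊆ Y ⊆ [1,N]} ρ^{|Y|} (1-ρ)^{N-|Y|} τ^{σ(S,Y)}
  = τ^{k(k+1)/2} ρ^k ∏_{i=1}^{k} (1 - ρ + τ^{k-i+1} ρ)^{s_i - s_{i-1} - 1}`. -/
theorem bernoulli_average_identity
    (ρ τ : ℝ) (N k : ℕ) (hN : 1 ≤ N) (hk : 1 ≤ k)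
    (s : ℕ → ℕ) (hs0 : s 0 = 0) (hmono : ∀ i, i < k → s i < s (i + 1))
    (S : Finset ℕ) (hS : S = (Finset.Icc 1 k).image s)
    (hSN : S ⊆ Finset.Icc 1 N) :
    ∑ Y ∈ (Finset.Icc 1 N).powerset.filter (fun Y => S ⊆ Y),
        ρ ^ Y.card * (1 - ρ) ^ (N - Y.card) * τ ^ sigmaPairs S Y =
      τ ^ (k * (k + 1) / 2) * ρ ^ k *
        ∏ i ∈ Finset.Icc 1 k,
          (1 - ρ + τ ^ (k - i + 1) * ρ) ^ (s i - s (i - 1) - 1) := by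
  have hinS : ∀ i, 1 ≤ i → i ≤ k → s i ∈ S := fun i h1 h2 =>
    hS ▸ Finset.mem_image_of_mem s (Finset.mem_Icc.mpr ⟨h1, h2⟩)
  have hsk : s k ≤ N := (Finset.mem_Icc.mp (hSN (hinS k hk le_rfl))).2
  rw [Finset.sum_congr rfl fun Y hY =>
      weight_eq_prod ρ τ N S (Finset.mem_powerset.mp (Finset.mem_filter.mp hY).1),
    sum_superset_prod_eq_prod_ite hSN]
  set F : ℕ → ℝ := fun y =>
    τ ^ (S.filter (fun u => y ≤ u)).card * ρ + if y ∈ S then 0 else 1 - ρ with hF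
  have hnot : ∀ j y, j ≤ k → s j < y → (j < k → y < s (j + 1)) → y ∉ S := by
    intro j y hjk hy hy' hyS
    obtain ⟨i, hi, rfl⟩ := Finset.mem_image.mp (hS ▸ hyS)
    have hik := (Finset.mem_Icc.mp hi).2
    rcases lt_trichotomy i (j + 1) with h | h | h
    · rcases (Nat.lt_succ_iff.mp h).eq_or_lt with rfl | h'
      · exact hy.false
      · exact hy.asymm (lt_of_lt_succ_of_le hmono h' hjk)
    · exact (hy' (by omega)).ne (by rw [h])
    · exact (hy' (by omega)).asymm (lt_of_lt_succ_of_le hmono h hik)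
  have htail : ∏ y ∈ Finset.Ioc (s k) N, F y = 1 := by
    refine Finset.prod_eq_one fun y hy => ?_
    have hy := (Finset.mem_Ioc.mp hy).1
    simp only [hF]
    rw [if_neg (hnot k y le_rfl hy fun h => absurd h (lt_irrefl k)), hS,
      card_filter_le_image hmono le_rfl hy fun h => absurd h (lt_irrefl k)]
    simp
  have hblock : ∀ i ∈ Finset.Icc 1 k, ∏ y ∈ Finset.Ioc (s (i - 1)) (s i), F y =
      (1 - ρ + τ ^ (k - i + 1) * ρ) ^ (s i - s (i - 1) - 1) * (τ ^ (k - i + 1) * ρ) := by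
    intro i hi
    obtain ⟨j, rfl⟩ : ∃ j, i = j + 1 := ⟨i - 1, by grind⟩
    have hjk : j < k := (Finset.mem_Icc.mp hi).2
    have hexp : k - (j + 1) + 1 = k - j := by omega
    rw [Nat.add_sub_cancel, hexp, prod_Ioc_eq_of_forall_lt (hmono j hjk)
      (c := 1 - ρ + τ ^ (k - j) * ρ)]
    · simp only [hF]
      rw [if_pos (hinS (j + 1) (by omega) hjk), hS,
        card_filter_le_image hmono hjk.le (hmono j hjk) fun _ => le_rfl, add_zero]
    · intro y hy hy'
      simp only [hF]
      rw [if_neg (hnot j y hjk.le hy fun _ => hy'), hS,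
        card_filter_le_image hmono hjk.le hy fun _ => hy'.le, add_comm]
  have hIcc : Finset.Icc 1 N = Finset.Ioc 0 N := by ext; simp [Nat.succ_le_iff]
  rw [hIcc, ← Finset.prod_Ioc_consecutive F (Nat.zero_le (s k)) hsk, htail, mul_one,
    prod_Ioc_eq_prod_Icc_blocks hs0 hmono, Finset.prod_congr rfl hblock,
    Finset.prod_mul_distrib, Finset.prod_mul_distrib, prod_Icc_pow_sub_add_one,
    Finset.prod_const, Nat.card_Icc, Nat.add_sub_cancel, mul_comm]
end

section
/- Let m ≥ 1 and let τ, z be complex numbers with |τ| < 1 and |z| < 1. Then the series ∑_{k=m}^{∞} [k−1 choose k−m]_τ · z^{k} converges and equals ∏_{j=1}^{m} z/(1 − τ^{m−j} z). -/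
open Finset

/-- The τ-binomial coefficient
`[N choose n]_τ = (1-τ^N)(1-τ^{N-1})⋯(1-τ^{N-n+1}) / ((1-τ)(1-τ^2)⋯(1-τ^n))`. -/
noncomputable def tBinom (τ : ℂ) (N n : ℕ) : ℂ :=
  (∏ j ∈ Finset.range n, (1 - τ ^ (N - j))) /
    (∏ j ∈ Finset.range n, (1 - τ ^ (j + 1)))

theorem hasSum_of_eq_mul_add {a b : ℕ → ℂ} {s w : ℂ} (hw : ‖w‖ < 1) (ha : HasSum a s)
    (h0 : b 0 = a 0) (hb : ∀ j, b (j + 1) = w * b j + a (j + 1)) :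
    HasSum b (s / (1 - w)) := by
  have hconv : ∀ j, b j = ∑ k ∈ Finset.range (j + 1), a k * w ^ (j - k) := by
    intro j
    induction j with
    | zero => simp [h0]
    | succ j ih =>
      rw [hb, ih, Finset.sum_range_succ _ (j + 1), Finset.mul_sum]
      congr 1
      · refine Finset.sum_congr rfl fun k hk => ?_
        rw [Nat.succ_sub (Nat.lt_succ_iff.mp (Finset.mem_range.mp hk)), pow_succ]
        ring
      · simp
  have hg := hasSum_geometric_of_norm_lt_one hw
  have h := hasSum_sum_range_mul_of_summable_norm ha.summable.norm hg.summable.norm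
  rw [ha.tsum_eq, hg.tsum_eq, ← div_eq_mul_inv] at h
  exact h.congr_fun hconv

theorem one_sub_pow_ne_zero_of_norm_lt_one {τ : ℂ} (hτ : ‖τ‖ < 1) (j : ℕ) :
    1 - τ ^ (j + 1) ≠ 0 := by
  intro h
  have hlt : ‖τ ^ (j + 1)‖ < 1 := by
    rw [norm_pow]
    exact pow_lt_one₀ (norm_nonneg _) hτ (Nat.succ_ne_zero j)
  rw [← sub_eq_zero.mp h, norm_one] at hlt
  exact lt_irrefl _ hlt

theorem tBinom_add_sub_one (τ : ℂ) (m j : ℕ) :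
    tBinom τ (m + j - 1) j = (∏ i ∈ Finset.range j, (1 - τ ^ (m + i))) /
      ∏ i ∈ Finset.range j, (1 - τ ^ (i + 1)) := by
  unfold tBinom
  rw [← Finset.prod_range_reflect (fun i => 1 - τ ^ (m + i))]
  congr 1
  refine Finset.prod_congr rfl fun i hi => ?_
  have := Finset.mem_range.mp hi
  congr 2
  omega

theorem tBinom_pascal {τ : ℂ} (hτ : ‖τ‖ < 1) (m j : ℕ) :
    tBinom τ (m + 1 + (j + 1) - 1) (j + 1) =
      τ ^ m * tBinom τ (m + 1 + j - 1) j + tBinom τ (m + (j + 1) - 1) (j + 1) := by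
  simp only [tBinom_add_sub_one]
  have hD : ∏ i ∈ Finset.range j, (1 - τ ^ (i + 1)) ≠ 0 :=
    Finset.prod_ne_zero_iff.mpr fun i _ => one_sub_pow_ne_zero_of_norm_lt_one hτ i
  have hj := one_sub_pow_ne_zero_of_norm_lt_one hτ j
  have hshift : ∏ i ∈ Finset.range (j + 1), (1 - τ ^ (m + i)) =
      (∏ i ∈ Finset.range j, (1 - τ ^ (m + 1 + i))) * (1 - τ ^ m) := by
    rw [Finset.prod_range_succ', add_zero]
    simp only [add_assoc, add_comm 1]
  rw [hshift, Finset.prod_range_succ _ j, Finset.prod_range_succ _ j]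
  field_simp
  ring

theorem hasSum_tBinom_mul_pow {τ z : ℂ} (hτ : ‖τ‖ < 1) (hz : ‖z‖ < 1) (m : ℕ) :
    HasSum (fun j : ℕ => tBinom τ (m + j - 1) j * z ^ j)
      (∏ i ∈ Finset.range m, 1 / (1 - τ ^ i * z)) := by
  induction m with
  | zero =>
    convert hasSum_single (0 : ℕ) (f := fun j : ℕ => tBinom τ (0 + j - 1) j * z ^ j) ?_ using 1
    · simp [tBinom]
    · intro j hj
      rw [tBinom_add_sub_one,
        Finset.prod_eq_zero (Finset.mem_range.mpr (Nat.pos_of_ne_zero hj)) (by simp)]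
      simp
  | succ m ih =>
    have hw : ‖τ ^ m * z‖ < 1 := by
      rw [norm_mul, norm_pow]
      exact (mul_le_of_le_one_left (norm_nonneg _)
        (pow_le_one₀ (norm_nonneg _) hτ.le)).trans_lt hz
    rw [Finset.prod_range_succ, mul_one_div]
    refine hasSum_of_eq_mul_add hw ih (by simp [tBinom]) fun j => ?_
    rw [tBinom_pascal hτ]
    ring

/-- The τ-binomial series identity from §IV of Tracy–Widom, "On ASEP with Step
Bernoulli Initial Condition": for `|τ| < 1`, `|z| < 1`,
`∑_{k=m}^{∞} [k-1 choose k-m]_τ z^k = ∏_{j=1}^{m} z/(1 - τ^{m-j} z)`.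
(The series is indexed by `k = m + j`, `j ∈ ℕ`, and the product is reindexed by
`j ↦ j + 1`.) -/
theorem tau_binomial_series
    (m : ℕ) (hm : 1 ≤ m) (τ z : ℂ) (hτ : ‖τ‖ < 1) (hz : ‖z‖ < 1) :
    HasSum (fun j : ℕ => tBinom τ (m + j - 1) j * z ^ (m + j))
      (∏ j ∈ Finset.range m, z / (1 - τ ^ (m - 1 - j) * z)) := by
  rw [Finset.prod_range_reflect (fun i => z / (1 - τ ^ i * z)) m]
  have hprod : ∏ i ∈ Finset.range m, z / (1 - τ ^ i * z) =
      z ^ m * ∏ i ∈ Finset.range m, 1 / (1 - τ ^ i * z) := by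
    simp [div_eq_mul_inv, Finset.prod_mul_distrib]
  rw [hprod]
  refine ((hasSum_tBinom_mul_pow hτ hz m).mul_left (z ^ m)).congr_fun fun j => ?_
  ring
end

section
/- Let s be a real number and δ > 0. Then the integral along the vertical line Re(ε) = δ satisfies (1/(2π)) ∫_{−∞}^{∞} e^{(δ+iy)^2/2 − s(δ+iy)} / (δ+iy) dy = 1 − G(s), where G(s) = (1/√(2π)) ∫_{−∞}^{s} e^{−z^2/2} dz is the standard Gaussian distribution function. Equivalently, 1 − (1/(2πi)) ∫_{δ−i∞}^{δ+i∞} e^{ε^2/2 − sε} dε/ε = G(s). -/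
open MeasureTheory

/-- The integrand of the Fubini argument, separated into a Gaussian factor and a decaying
exponential. -/
lemma integrable_gaussian_line_mul_exp (s δ : ℝ) (hδ : 0 < δ) :
    Integrable (Function.uncurry fun (y t : ℝ) ↦
        Complex.exp (((δ : ℂ) + y * Complex.I) ^ 2 / 2) *
          Complex.exp (-((δ : ℂ) + y * Complex.I) * t))
      (volume.prod (volume.restrict (Set.Ioi s))) := by
  have hy : Integrable fun y : ℝ ↦ Complex.exp (((δ : ℂ) + y * Complex.I) ^ 2 / 2) := by
    convert integrable_cexp_quadratic' (b := -1 / 2) (by norm_num) (δ * Complex.I) (δ ^ 2 / 2)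
      using 3 with y
    linear_combination (y ^ 2 / 2 : ℂ) * Complex.I_sq
  have ht : Integrable (fun t : ℝ ↦ Real.exp (-δ * t)) (volume.restrict (Set.Ioi s)) :=
    integrableOn_exp_mul_Ioi (neg_lt_zero.mpr hδ) s
  refine (hy.mul_prod ht.ofReal).mono (by fun_prop) (.of_forall fun p ↦ le_of_eq ?_)
  simp [Function.uncurry, Complex.norm_exp]

lemma integral_gaussian_line (δ t : ℝ) :
    ∫ y : ℝ, Complex.exp (((δ : ℂ) + y * Complex.I) ^ 2 / 2) *
        Complex.exp (-((δ : ℂ) + y * Complex.I) * t) =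
      ((√(2 * Real.pi) * Real.exp (-t ^ 2 / 2) : ℝ) : ℂ) := by
  have h := integral_cexp_quadratic (b := -1 / 2) (by norm_num)
    ((δ - t) * Complex.I) (δ ^ 2 / 2 - t * δ)
  calc
    _ = ∫ y : ℝ, Complex.exp (-1 / 2 * (y : ℂ) ^ 2 + (δ - t) * Complex.I * y +
          (δ ^ 2 / 2 - t * δ)) := by
      congr with y
      rw [← Complex.exp_add]
      congr 1
      linear_combination (y ^ 2 / 2 : ℂ) * Complex.I_sq
    _ = _ := by
      rw [h, Real.sqrt_eq_rpow]
      push_cast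
      rw [Complex.ofReal_cpow (by positivity)]
      congr 2
      · push_cast
        ring
      · norm_num
      · linear_combination ((δ - t) ^ 2 / 2 : ℂ) * Complex.I_sq

lemma integral_exp_neg_sq_div_two_Iic_add_Ioi (s : ℝ) :
    (∫ z in Set.Iic s, Real.exp (-z ^ 2 / 2)) + ∫ z in Set.Ioi s, Real.exp (-z ^ 2 / 2) =
      √(2 * Real.pi) := by
  have hexp (z : ℝ) : Real.exp (-z ^ 2 / 2) = Real.exp (-(1 / 2) * z ^ 2) := by
    congr 1
    ring
  have hi := integrable_exp_neg_mul_sq (b := 1 / 2) (by norm_num)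
  simp_rw [hexp]
  rw [intervalIntegral.integral_Iic_add_Ioi hi.integrableOn hi.integrableOn, integral_gaussian]
  congr 1
  ring

/-- The Gaussian contour integral from §V of Tracy–Widom, "On ASEP with Step
Bernoulli Initial Condition": for `δ > 0`, parametrizing the vertical line
`Re ε = δ` by `ε = δ + iy`,
`(1/(2π)) ∫_{-∞}^{∞} e^{(δ+iy)²/2 - s(δ+iy)}/(δ+iy) dy = 1 - G(s)`,
where `G(s) = (1/√(2π)) ∫_{-∞}^{s} e^{-z²/2} dz`. -/
theorem gaussian_contour_integral (s δ : ℝ) (hδ : 0 < δ) :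
    (1 / (2 * Real.pi) : ℂ) *
        ∫ y : ℝ,
          Complex.exp (((δ : ℂ) + y * Complex.I) ^ 2 / 2
              - (s : ℂ) * ((δ : ℂ) + y * Complex.I)) /
            ((δ : ℂ) + y * Complex.I) =
      1 - (((Real.sqrt (2 * Real.pi))⁻¹ *
        ∫ z in Set.Iic s, Real.exp (-z ^ 2 / 2) : ℝ) : ℂ) := by
  have hline (y : ℝ) :
      Complex.exp (((δ : ℂ) + y * Complex.I) ^ 2 / 2 - (s : ℂ) * ((δ : ℂ) + y * Complex.I)) /
          ((δ : ℂ) + y * Complex.I) =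
        ∫ t in Set.Ioi s, Complex.exp (((δ : ℂ) + y * Complex.I) ^ 2 / 2) *
          Complex.exp (-((δ : ℂ) + y * Complex.I) * t) := by
    rw [integral_const_mul, integral_exp_mul_complex_Ioi (by simpa using hδ), neg_div_neg_eq,
      ← mul_div_assoc, ← Complex.exp_add]
    congr 2
    ring
  simp_rw [hline]
  rw [integral_integral_swap (integrable_gaussian_line_mul_exp s δ hδ)]
  simp_rw [integral_gaussian_line]
  rw [integral_complex_ofReal, integral_const_mul,
    eq_sub_of_add_eq' (integral_exp_neg_sq_div_two_Iic_add_Ioi s)]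
  have hsqrt : √(2 * Real.pi) ≠ 0 := by positivity
  norm_cast
  nth_rewrite 1 [← Real.sq_sqrt (show 0 ≤ 2 * Real.pi by positivity)]
  field_simp
end

section
/- Let 0 < ρ < 1 and σ > 0, and set c_1' = σ/ρ + ρ − 1 and ζ_0 = −ρ/(1−ρ). Define g : (−∞, 0) → ℝ by g(ζ) = −c_1' · log(1−ζ) + ζ/(1−ζ) + σ · log(−ζ). Then g is twice differentiable at ζ_0 with g'(ζ_0) = 0 and g''(ζ_0) = −(1−ρ)^3 (σ − ρ^2)/ρ^2. In particular, when σ > ρ^2 the point ζ_0 is a nondegenerate critical point with g''(ζ_0) < 0. -/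
/-- The first derivative of the exponent `-c log(1-z) + z/(1-z) + σ log(-z)` on `z < 0`. -/
theorem hasDerivAt_exponent (c σ : ℝ) {z : ℝ} (hz : z < 0) :
    HasDerivAt (fun z : ℝ => -c * Real.log (1 - z) + z / (1 - z) + σ * Real.log (-z))
      (c / (1 - z) + 1 / (1 - z) ^ 2 + σ / z) z := by
  have hz' : z ≠ 0 := hz.ne
  have h1 : 1 - z ≠ 0 := by linarith
  have hsub : HasDerivAt (fun z : ℝ => 1 - z) (-1) z := (hasDerivAt_id z).const_sub 1
  refine ((((hsub.log h1).const_mul (-c)).add ((hasDerivAt_id z).div hsub h1)).add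
    (((hasDerivAt_id z).neg.log (neg_ne_zero.mpr hz')).const_mul σ)).congr_deriv ?_
  simp only [id, Pi.neg_apply]
  field_simp
  ring

/-- The second derivative of the exponent `-c log(1-z) + z/(1-z) + σ log(-z)` on `z < 0`. -/
theorem hasDerivAt_deriv_exponent (c σ : ℝ) {z : ℝ} (hz : z < 0) :
    HasDerivAt (fun z : ℝ => c / (1 - z) + 1 / (1 - z) ^ 2 + σ / z)
      (c / (1 - z) ^ 2 + 2 / (1 - z) ^ 3 - σ / z ^ 2) z := by
  have hz' : z ≠ 0 := hz.ne
  have h1 : 1 - z ≠ 0 := by linarith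
  have hsub : HasDerivAt (fun z : ℝ => 1 - z) (-1) z := (hasDerivAt_id z).const_sub 1
  refine ((((hasDerivAt_const z c).div hsub h1).add
    ((hasDerivAt_const z (1 : ℝ)).div (hsub.pow 2) (pow_ne_zero 2 h1))).add
    ((hasDerivAt_const z σ).div (hasDerivAt_id z) hz')).congr_deriv ?_
  simp only [id, Pi.pow_apply]
  field_simp
  ring


/-- The saddle point computation in the Gaussian regime, §V of Tracy–Widom,
"On ASEP with Step Bernoulli Initial Condition": with `c₁' = σ/ρ + ρ - 1` and
`ζ₀ = -ρ/(1-ρ)`, the exponent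
`g(ζ) = -c₁' log(1-ζ) + ζ/(1-ζ) + σ log(-ζ)` (defined for `ζ < 0`)
is twice differentiable at `ζ₀` with `g'(ζ₀) = 0` and
`g''(ζ₀) = -(1-ρ)³(σ-ρ²)/ρ²`; in particular `g''(ζ₀) < 0` when `σ > ρ²`. -/
theorem gaussian_regime_saddle_point
    (ρ σ : ℝ) (hρ0 : 0 < ρ) (hρ1 : ρ < 1) (hσ : 0 < σ)
    (c₁' ζ₀ : ℝ) (hc : c₁' = σ / ρ + ρ - 1) (hζ : ζ₀ = -ρ / (1 - ρ))
    (g : ℝ → ℝ)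
    (hg : ∀ ζ < (0 : ℝ),
      g ζ = -c₁' * Real.log (1 - ζ) + ζ / (1 - ζ) + σ * Real.log (-ζ)) :
    HasDerivAt g 0 ζ₀ ∧
      HasDerivAt (deriv g) (-(1 - ρ) ^ 3 * (σ - ρ ^ 2) / ρ ^ 2) ζ₀ ∧
      (ρ ^ 2 < σ → deriv (deriv g) ζ₀ < 0) := by
  have hρ : 0 < 1 - ρ := sub_pos.mpr hρ1
  have hζ_neg : ζ₀ < 0 := hζ ▸ div_neg_of_neg_of_pos (neg_neg_of_pos hρ0) hρ
  have hone : 1 - ζ₀ = 1 / (1 - ρ) := by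
    rw [hζ]
    field_simp
    ring
  have hg' : ∀ z < (0 : ℝ), HasDerivAt g (c₁' / (1 - z) + 1 / (1 - z) ^ 2 + σ / z) z :=
    fun z hz => (hasDerivAt_exponent c₁' σ hz).congr_of_eventuallyEq <| by
      filter_upwards [Iio_mem_nhds hz] with w hw using hg w hw
  have hfirst : HasDerivAt g 0 ζ₀ := by
    refine (hg' ζ₀ hζ_neg).congr_deriv ?_
    rw [hone, hζ, hc]
    field_simp
    ring
  have hsecond : HasDerivAt (deriv g) (-(1 - ρ) ^ 3 * (σ - ρ ^ 2) / ρ ^ 2) ζ₀ := by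
    have hderiv : deriv g =ᶠ[nhds ζ₀]
        fun z => c₁' / (1 - z) + 1 / (1 - z) ^ 2 + σ / z := by
      filter_upwards [Iio_mem_nhds hζ_neg] with z hz using (hg' z hz).deriv
    refine ((hasDerivAt_deriv_exponent c₁' σ hζ_neg).congr_of_eventuallyEq
      hderiv).congr_deriv ?_
    rw [hone, hζ, hc]
    field_simp
    ring
  refine ⟨hfirst, hsecond, fun h => ?_⟩
  rw [hsecond.deriv, neg_mul, neg_div]
  have := sub_pos.mpr h
  exact neg_neg_of_pos (by positivity)
end

section
/- Let 0 < τ < 1, let α ≥ 0 and t be real numbers, let x be an integer, and let ε be a complex number with |ε| < 1 and 1 + α τ^{n} ε ≠ 0 for all integers n ≥ 0. Define φ(η) = ((1−τη)/(1−η))^{x} · e^{(1/(1−η) − 1/(1−τη)) t} / (1 + αη) for those complex η with η ≠ 1, τη ≠ 1, and 1 + αη ≠ 0. Then the infinite product ∏_{n=0}^{∞} φ(τ^{n} ε) converges and equals (1−ε)^{−x} · e^{(ε/(1−ε)) t} · ∏_{n=0}^{∞} 1/(1 + τ^{n} α ε). -/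
open Filter Topology

/-- Integer powers of a convergent product with nonzero value. -/
theorem HasProd.zpow_of_ne_zero {ι : Type*} {f : ι → ℂ} {a : ℂ} (h : HasProd f a) (ha : a ≠ 0)
    (x : ℤ) : HasProd (fun i => f i ^ x) (a ^ x) := by
  simp only [HasProd, Finset.prod_zpow]
  exact Tendsto.zpow₀ h x (Or.inl ha)

theorem one_sub_pow_mul_ne_zero {q z : ℂ} (hq : ‖q‖ < 1) (hz : ‖z‖ < 1) (n : ℕ) :
    1 - q ^ n * z ≠ 0 := by
  intro h
  have h1 : ‖q ^ n * z‖ = 1 := by rw [← sub_eq_zero.mp h, norm_one]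
  rw [norm_mul, norm_pow] at h1
  nlinarith [pow_le_one₀ (n := n) (norm_nonneg q) hq.le, norm_nonneg z]

theorem summable_pow_mul_of_norm_lt_one {q : ℂ} (hq : ‖q‖ < 1) (z : ℂ) :
    Summable fun n : ℕ => q ^ n * z :=
  (summable_geometric_of_norm_lt_one hq).mul_right z

theorem tendsto_one_sub_pow_mul {q : ℂ} (hq : ‖q‖ < 1) (z : ℂ) :
    Tendsto (fun n : ℕ => 1 - q ^ n * z) atTop (𝓝 1) := by
  simpa using (summable_pow_mul_of_norm_lt_one hq z).tendsto_atTop_zero.const_sub 1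

theorem summable_pow_mul_div_one_sub {q z : ℂ} (hq : ‖q‖ < 1) (hz : ‖z‖ < 1) :
    Summable fun n : ℕ => q ^ n * z / (1 - q ^ n * z) := by
  have hz' : 0 < 1 - ‖z‖ := sub_pos.mpr hz
  refine Summable.of_norm_bounded
    (((summable_pow_mul_of_norm_lt_one hq z).norm).div_const (1 - ‖z‖)) fun n => ?_
  rw [norm_div]
  refine div_le_div_of_nonneg_left (norm_nonneg _) hz' ?_
  have h1 : ‖q ^ n * z‖ ≤ ‖z‖ := by
    rw [norm_mul, norm_pow]
    exact mul_le_of_le_one_left (norm_nonneg z) (pow_le_one₀ (norm_nonneg q) hq.le)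
  have h2 := norm_sub_norm_le (1 : ℂ) (q ^ n * z)
  rw [norm_one] at h2
  linarith

theorem hasProd_one_sub_pow_succ_div {q z : ℂ} (hq : ‖q‖ < 1) (hz : ‖z‖ < 1) :
    HasProd (fun n : ℕ => (1 - q * (q ^ n * z)) / (1 - q ^ n * z)) (1 - z)⁻¹ := by
  have hne := one_sub_pow_mul_ne_zero hq hz
  have hm : Multipliable fun n : ℕ => (1 - q * (q ^ n * z)) / (1 - q ^ n * z) := by
    refine (multipliable_one_add_of_summable
      ((summable_pow_mul_div_one_sub hq hz).mul_left (1 - q)).norm).congr fun n => ?_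
    have := hne n
    field_simp
    ring
  have hprod (N : ℕ) : ∏ n ∈ Finset.range N, (1 - q * (q ^ n * z)) / (1 - q ^ n * z) =
      (1 - q ^ N * z) / (1 - z) := by
    induction N with
    | zero =>
      have := hne 0
      simp_all
    | succ N ih =>
      have h0 := hne 0
      have hN := hne N
      rw [pow_zero, one_mul] at h0
      rw [Finset.prod_range_succ, ih, pow_succ]
      field_simp
  rw [hm.hasProd_iff_tendsto_nat]
  simp only [hprod]
  simpa using (tendsto_one_sub_pow_mul hq z).div_const (1 - z)

theorem hasSum_inv_one_sub_sub_inv_one_sub {q z : ℂ} (hq : ‖q‖ < 1) (hz : ‖z‖ < 1) :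
    HasSum (fun n : ℕ => 1 / (1 - q ^ n * z) - 1 / (1 - q * (q ^ n * z))) (z / (1 - z)) := by
  have hne := one_sub_pow_mul_ne_zero hq hz
  have hc := summable_pow_mul_div_one_sub hq hz
  have hterm (n : ℕ) : 1 / (1 - q ^ n * z) - 1 / (1 - q * (q ^ n * z)) =
      q ^ n * z / (1 - q ^ n * z) - q ^ (n + 1) * z / (1 - q ^ (n + 1) * z) := by
    have h0 := hne n
    have h1 := hne (n + 1)
    rw [show q * (q ^ n * z) = q ^ (n + 1) * z by ring, div_sub_div _ _ h0 h1,
      div_sub_div _ _ h0 h1]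
    ring
  simp only [hterm]
  rw [(hc.sub ((summable_nat_add_iff 1).mpr hc)).hasSum_iff_tendsto_nat]
  simp only [Finset.sum_range_sub']
  simpa using hc.tendsto_atTop_zero.const_sub (z / (1 - z))

/-- The infinite product formula (15) from §V of Tracy–Widom, "On ASEP with
Step Bernoulli Initial Condition": with
`φ(η) = ((1-τη)/(1-η))^x e^{(1/(1-η) - 1/(1-τη)) t} / (1 + αη)`,
for `0 < τ < 1`, `α ≥ 0`, `x ∈ ℤ`, `|ε| < 1`, and `1 + ατⁿε ≠ 0` for all `n`,
the infinite product `∏_{n=0}^{∞} φ(τⁿ ε)` converges and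
`φ_∞(ε) = ∏_{n=0}^{∞} φ(τⁿ ε)
  = (1-ε)^{-x} e^{(ε/(1-ε)) t} ∏_{n=0}^{∞} 1/(1 + τⁿ α ε)`. -/
theorem infinite_product_phi
    (τ α t : ℝ) (hτ0 : 0 < τ) (hτ1 : τ < 1) (hα : 0 ≤ α) (x : ℤ)
    (ε : ℂ) (hε : ‖ε‖ < 1)
    (hne : ∀ n : ℕ, 1 + (τ : ℂ) ^ n * (α : ℂ) * ε ≠ 0)
    (φ : ℂ → ℂ)
    (hφ : ∀ η : ℂ, η ≠ 1 → (τ : ℂ) * η ≠ 1 → 1 + (α : ℂ) * η ≠ 0 →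
      φ η = ((1 - (τ : ℂ) * η) / (1 - η)) ^ x *
        Complex.exp ((1 / (1 - η) - 1 / (1 - (τ : ℂ) * η)) * (t : ℂ)) /
          (1 + (α : ℂ) * η)) :
    Multipliable (fun n : ℕ => φ ((τ : ℂ) ^ n * ε)) ∧
      ∏' n : ℕ, φ ((τ : ℂ) ^ n * ε) =
        (1 - ε) ^ (-x) * Complex.exp (ε / (1 - ε) * (t : ℂ)) *
          ∏' n : ℕ, (1 / (1 + (τ : ℂ) ^ n * (α : ℂ) * ε)) := by
  have hq : ‖(τ : ℂ)‖ < 1 := by rwa [Complex.norm_of_nonneg hτ0.le]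
  have h1 := one_sub_pow_mul_ne_zero hq hε
  have hs : Summable fun n : ℕ => ‖(τ : ℂ) ^ n * (α : ℂ) * ε‖ := by
    simpa only [mul_assoc] using (summable_pow_mul_of_norm_lt_one hq ((α : ℂ) * ε)).norm
  have hden : HasProd (fun n : ℕ => 1 / (1 + (τ : ℂ) ^ n * (α : ℂ) * ε))
      (∏' n : ℕ, (1 + (τ : ℂ) ^ n * (α : ℂ) * ε))⁻¹ := by
    simpa only [one_div] using (multipliable_one_add_of_summable hs).hasProd.inv₀
      (tprod_one_add_ne_zero_of_summable hne hs)
  have hz : (1 - ε)⁻¹ ≠ 0 := inv_ne_zero (by simpa using h1 0)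
  have hpow := (hasProd_one_sub_pow_succ_div hq hε).zpow_of_ne_zero hz x
  have hexp := ((hasSum_inv_one_sub_sub_inv_one_sub hq hε).mul_right (t : ℂ)).cexp
  have hmain := (hpow.mul hexp).mul hden
  rw [inv_zpow', ← hden.tprod_eq] at hmain
  have heq : (fun n : ℕ => φ ((τ : ℂ) ^ n * ε)) = fun n : ℕ =>
      ((1 - (τ : ℂ) * ((τ : ℂ) ^ n * ε)) / (1 - (τ : ℂ) ^ n * ε)) ^ x *
        Complex.exp ((1 / (1 - (τ : ℂ) ^ n * ε) - 1 / (1 - (τ : ℂ) * ((τ : ℂ) ^ n * ε))) *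
          (t : ℂ)) * (1 / (1 + (τ : ℂ) ^ n * (α : ℂ) * ε)) := by
    funext n
    have hcomm : (τ : ℂ) ^ n * (α : ℂ) * ε = (α : ℂ) * ((τ : ℂ) ^ n * ε) := by ring
    have hsucc := h1 (n + 1)
    rw [pow_succ', mul_assoc] at hsucc
    rw [hφ _ (sub_ne_zero.mp (h1 n)).symm (sub_ne_zero.mp hsucc).symm (hcomm ▸ hne n), hcomm,
      mul_one_div]
  rw [heq]
  exact ⟨hmain.multipliable, hmain.tprod_eq⟩
end
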